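/- arXiv:1412.7611 — 2 statements merged into one kernel-verified Lean document; each statement's English description precedes it below -/
import Mathlib

section
/- Let F contain a primitive p-th root of unity, let a, b ∈ F^× be linearly independent modulo (F^×)^p, let k < p be a positive integer, and assume χ_a ∪ χ_b is the coboundary of a continuous 1-cochain on G_F. Then: (1) the (k+1)-fold Massey products ⟨χ_b, χ_a, …, χ_a⟩ and ⟨χ_a, …, χ_a, χ_b⟩ (each with k copies of χ_a) are defined and contain 0; and (2) the (k+2)-fold Massey products ⟨χ_a, χ_b, χ_a, …, χ_a⟩ and ⟨χ_a, …, χ_a, χ_b, χ_a⟩ (each with k+1 copies of χ_a) are defined and contain 0. -/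
/-- Continuity of a map from a topological space to `ZMod p`, the latter regarded
as a discrete space: all fibers are open. -/
def Cts {G : Type*} [TopologicalSpace G] {p : ℕ} (f : G → ZMod p) : Prop :=
  ∀ x : ZMod p, IsOpen (f ⁻¹' {x})

/-- `M = {M i j : 1 ≤ i < j ≤ n+1}` is a complete defining system for the `n`-tuple
`(a 1, …, a n)` of continuous homomorphisms `G → 𝔽_p`; its existence says exactly that
the `n`-fold Massey product `⟨a 1, …, a n⟩` is defined and contains `0`. -/
def IsCompleteDefiningSystem {G : Type*} [Group G] [TopologicalSpace G] {p : ℕ}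
    (n : ℕ) (a : ℕ → G → ZMod p) (M : ℕ → ℕ → G → ZMod p) : Prop :=
  (∀ i j, 1 ≤ i → i < j → j ≤ n + 1 → Cts (M i j)) ∧
  (∀ i, 1 ≤ i → i ≤ n → M i (i + 1) = a i) ∧
  (∀ i j, 1 ≤ i → i + 1 < j → j ≤ n + 1 → ∀ σ τ : G,
    M i j σ + M i j τ - M i j (σ * τ) = ∑ l ∈ Finset.Ico (i + 1) j, M i l σ * M l j τ)

/-- `χ` is the Kummer character attached to the `p`-th root `r`, with respect to the
primitive `p`-th root of unity `ξ` of `F`: `σ r = ξ^(χ σ) * r` for all `σ ∈ G_F`. -/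
def IsKummerChar {F Fs : Type*} [Field F] [Field Fs] [Algebra F Fs]
    {p : ℕ} (ξ : F) (r : Fs) (χ : (Fs ≃ₐ[F] Fs) → ZMod p) : Prop :=
  ∀ σ : Fs ≃ₐ[F] Fs, σ r = algebraMap F Fs ξ ^ (χ σ).val * r

/-- `a` and `b` are linearly independent modulo `(F^×)^p`. -/
def LinIndepModP (p : ℕ) {F : Type*} [Field F] (a b : F) : Prop :=
  ∀ m n : ℤ, (∃ y : F, y ≠ 0 ∧ a ^ m * b ^ n = y ^ (p : ℤ)) → (p : ℤ) ∣ m ∧ (p : ℤ) ∣ n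


namespace MasseyVanishing

open Finset

lemma cts_iff_isLocallyConstant {G : Type*} [TopologicalSpace G] {p : ℕ} {f : G → ZMod p} :
    Cts f ↔ IsLocallyConstant f :=
  IsLocallyConstant.iff_isOpen_fiber.symm

section AdditiveCharacter

variable {G R : Type*} [Group G] [Ring R] {χ : G → R}

lemma char_one (hχ : ∀ σ τ, χ (σ * τ) = χ σ + χ τ) : χ 1 = 0 := by
  simpa using hχ 1 1

lemma char_inv (hχ : ∀ σ τ, χ (σ * τ) = χ σ + χ τ) (σ : G) : χ σ⁻¹ = -χ σ := by
  rw [eq_neg_iff_add_eq_zero, ← hχ, inv_mul_cancel, char_one hχ]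

lemma char_pow (hχ : ∀ σ τ, χ (σ * τ) = χ σ + χ τ) (σ : G) (n : ℕ) : χ (σ ^ n) = n * χ σ := by
  induction n with
  | zero => simpa using char_one hχ
  | succ n ih => rw [pow_succ, hχ, ih, Nat.cast_succ, add_mul, one_mul]

end AdditiveCharacter

/-- The divided power `x ^ d / d!`. -/
def dividedPow {p : ℕ} (d : ℕ) (x : ZMod p) : ZMod p := x ^ d * (d.factorial : ZMod p)⁻¹

section DividedPow

variable {p : ℕ}

lemma dividedPow_zero (x : ZMod p) : dividedPow 0 x = 1 := by
  simp [dividedPow]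

lemma dividedPow_one (x : ZMod p) : dividedPow 1 x = x := by
  simp [dividedPow]

variable [Fact p.Prime]

lemma dividedPow_add {d : ℕ} (hd : d < p) (x y : ZMod p) :
    dividedPow d (x + y) = ∑ e ∈ range (d + 1), dividedPow e x * dividedPow (d - e) y := by
  have hfac : ∀ e ≤ d, (e.factorial : ZMod p) ≠ 0 := fun e he h => by
    rw [ZMod.natCast_eq_zero_iff, (Fact.out : p.Prime).dvd_factorial] at h
    omega
  rw [dividedPow, add_pow, sum_mul]
  refine sum_congr rfl fun e he => ?_
  have hed : e ≤ d := Nat.lt_succ_iff.mp (mem_range.mp he)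
  have hchoose : (d.choose e : ZMod p) * e.factorial * (d - e).factorial = d.factorial := by
    exact_mod_cast congrArg (Nat.cast : ℕ → ZMod p) (Nat.choose_mul_factorial_mul_factorial hed)
  have h₁ := hfac e hed
  have h₂ := hfac d le_rfl
  have h₃ := hfac (d - e) (Nat.sub_le d e)
  rw [dividedPow, dividedPow]
  field_simp
  linear_combination x ^ e * y ^ (d - e) * hchoose

end DividedPow

section Moments

variable {G : Type*} {p : ℕ} (χ : G → ZMod p) (f : ZMod p → G → ZMod p)

/-- The entries of the unipotent block attached to the character `χ`. -/
def charBlock (d : ℕ) (σ : G) : ZMod p := -dividedPow d (-χ σ)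

variable [Fact p.Prime]

/-- The moments of a cocycle `f` with values in the induced module. -/
def moment (d : ℕ) (σ : G) : ZMod p := ∑ i, dividedPow d i * f i σ

/-- The moments of the explicit cochain bounding the cup product of `χ` and `f`. -/
def cupMoment (d : ℕ) (σ : G) : ZMod p := moment (fun i σ => -((i + χ σ) * f i σ)) d σ

end Moments

section LocallyConstant

variable {X : Type*} [TopologicalSpace X] {p : ℕ}

lemma isLocallyConstant_charBlock {χ : X → ZMod p} (hχ : IsLocallyConstant χ) (d : ℕ) :
    IsLocallyConstant (charBlock χ d) :=
  hχ.comp fun x => -dividedPow d (-x)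

lemma isLocallyConstant_moment [Fact p.Prime] {f : ZMod p → X → ZMod p}
    (hf : ∀ i, IsLocallyConstant (f i)) (d : ℕ) : IsLocallyConstant (moment f d) := by
  rw [IsLocallyConstant.iff_eventually_eq]
  intro σ
  filter_upwards [Filter.eventually_all.mpr fun i => (hf i).eventually_eq σ] with τ hτ
  simp only [moment, hτ]

end LocallyConstant

section Cochains

variable {G : Type*} [Group G] {p : ℕ} [Fact p.Prime] {χ : G → ZMod p} {f : ZMod p → G → ZMod p}

lemma charBlock_coboundary (hχ : ∀ σ τ, χ (σ * τ) = χ σ + χ τ) {d : ℕ} (hd0 : 1 ≤ d)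
    (hd : d < p) (σ τ : G) :
    charBlock χ d σ + charBlock χ d τ - charBlock χ d (σ * τ) =
      ∑ e ∈ Ico 1 d, charBlock χ e σ * charBlock χ (d - e) τ := by
  simp only [charBlock, hχ, neg_add, neg_mul_neg]
  rw [dividedPow_add hd, sum_range_succ, range_eq_Ico, sum_eq_sum_Ico_succ_bot (by omega)]
  simp only [dividedPow_zero, Nat.sub_self, Nat.sub_zero, zero_add]
  ring

/-- A cochain whose coboundary in the induced module is `g` has moments with the
corresponding twisted coboundary. -/
lemma moment_coboundary {e : ZMod p → G → ZMod p} {g : ZMod p → ZMod p}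
    {d : ℕ} (hd : d < p) {σ τ : G}
    (he : ∀ i, e i τ + e (i + χ τ) σ - e i (σ * τ) = g i) :
    moment e d σ + moment e d τ - moment e d (σ * τ) =
      ∑ i, dividedPow d i * g i + ∑ m ∈ range d, moment e m σ * charBlock χ (d - m) τ := by
  have hshift : ∑ i, dividedPow d i * e (i + χ τ) σ =
      ∑ m ∈ range (d + 1), moment e m σ * dividedPow (d - m) (-χ τ) := by
    calc ∑ i, dividedPow d i * e (i + χ τ) σ
        = ∑ i, dividedPow d (i + -χ τ) * e i σ :=
          Fintype.sum_equiv (Equiv.addRight (χ τ)) _ _ fun i => by simp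
      _ = _ := by
          simp only [dividedPow_add hd, moment, sum_mul]
          rw [sum_comm]
          exact sum_congr rfl fun _ _ => sum_congr rfl fun _ _ => by ring
  rw [sum_range_succ] at hshift
  simp only [Nat.sub_self, dividedPow_zero, mul_one] at hshift
  have hg : ∑ i, dividedPow d i * g i =
      moment e d τ + ∑ i, dividedPow d i * e (i + χ τ) σ - moment e d (σ * τ) := by
    simp only [moment, ← sum_add_distrib, ← sum_sub_distrib]
    exact sum_congr rfl fun i _ => by rw [← he i]; ring
  rw [hg, hshift]
  simp only [charBlock, mul_neg, sum_neg_distrib]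
  ring

variable [TopologicalSpace G]

lemma exists_isCompleteDefiningSystem_head {ψ : G → ZMod p} {k : ℕ}
    (hχ : ∀ σ τ, χ (σ * τ) = χ σ + χ τ) (hχc : IsLocallyConstant χ)
    (hfc : ∀ i, IsLocallyConstant (f i))
    (hf : ∀ i σ τ, f i (σ * τ) = f i τ + f (i + χ τ) σ)
    (hfψ : ∀ σ, ∑ i, f i σ = ψ σ) (hkp : k < p) :
    ∃ M, IsCompleteDefiningSystem (k + 1) (fun i σ => if i = 1 then ψ σ else χ σ) M := by
  refine ⟨fun i j => if i = 1 then moment f (j - 2) else charBlock χ (j - i), ?_, ?_, ?_⟩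
  · intro i j _ _ _
    rw [cts_iff_isLocallyConstant]
    dsimp only
    split_ifs
    exacts [isLocallyConstant_moment hfc _, isLocallyConstant_charBlock hχc _]
  · intro i _ _
    funext σ
    dsimp only
    split_ifs with h
    · simp [h, moment, dividedPow_zero, hfψ]
    · simp [charBlock, dividedPow_one]
  · intro i j hi hij hj σ τ
    dsimp only
    split_ifs with h
    · subst h
      rw [moment_coboundary (χ := χ) (g := 0) (by omega) (fun i => by rw [hf]; simp)]
      simp only [Pi.zero_apply, mul_zero, sum_const_zero, zero_add]
      rw [sum_Ico_eq_sum_range]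
      refine sum_congr rfl fun m _ => ?_
      rw [if_neg (by omega)]
      congr 2 <;> omega
    · rw [charBlock_coboundary hχ (by omega) (by omega), sum_Ico_eq_sum_range,
        sum_Ico_eq_sum_range]
      refine sum_congr (by congr 1) fun m _ => ?_
      rw [if_neg (by omega)]
      congr 2 <;> omega

lemma exists_isCompleteDefiningSystem_second {ψ : G → ZMod p} {k : ℕ}
    (hχ : ∀ σ τ, χ (σ * τ) = χ σ + χ τ) (hχc : IsLocallyConstant χ)
    (hfc : ∀ i, IsLocallyConstant (f i))
    (hf : ∀ i σ τ, f i (σ * τ) = f i τ + f (i + χ τ) σ)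
    (hfψ : ∀ σ, ∑ i, f i σ = ψ σ) (hkp : k < p) :
    ∃ M, IsCompleteDefiningSystem (k + 2) (fun i σ => if i = 2 then ψ σ else χ σ) M := by
  have hcup : ∀ i, IsLocallyConstant fun σ => -((i + χ σ) * f i σ) := fun i =>
    hχc.comp₂ (hfc i) fun x y => -((i + x) * y)
  refine ⟨fun i j => if i = 1 then (if j = 2 then χ else cupMoment χ f (j - 3)) else
    if i = 2 then moment f (j - 3) else charBlock χ (j - i), ?_, ?_, ?_⟩
  · intro i j _ _ _
    rw [cts_iff_isLocallyConstant]
    dsimp only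
    split_ifs
    exacts [hχc, isLocallyConstant_moment hcup _, isLocallyConstant_moment hfc _,
      isLocallyConstant_charBlock hχc _]
  · intro i _ _
    funext σ
    rcases eq_or_ne i 1 with rfl | h1
    · simp
    rcases eq_or_ne i 2 with rfl | h2
    · simp [moment, dividedPow_zero, hfψ]
    · simp [h1, h2, charBlock, dividedPow_one]
  · intro i j hi hij hj σ τ
    dsimp only
    rcases eq_or_ne i 1 with rfl | h1
    · simp only [if_true, if_neg (show j ≠ 2 by omega)]
      unfold cupMoment
      rw [moment_coboundary (χ := χ) (g := fun i => χ σ * f i τ) (by omega)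
          (fun i => by rw [hf, hχ]; ring),
        sum_eq_sum_Ico_succ_bot (by omega), sum_Ico_eq_sum_range]
      congr 1
      · change _ = χ σ * moment f (j - 3) τ
        rw [moment, mul_sum]
        exact sum_congr rfl fun _ _ => by ring
      · refine sum_congr (by congr 1) fun m _ => ?_
        rw [if_neg (by omega), if_neg (by omega), if_neg (by omega)]
        congr 2 <;> omega
    rcases eq_or_ne i 2 with rfl | h2
    · simp only [if_true, if_neg h1]
      rw [moment_coboundary (χ := χ) (g := 0) (by omega) (fun i => by rw [hf]; simp)]
      simp only [Pi.zero_apply, mul_zero, sum_const_zero, zero_add]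
      rw [sum_Ico_eq_sum_range]
      refine sum_congr rfl fun m _ => ?_
      rw [if_neg (by omega), if_neg (by omega)]
      congr 2 <;> omega
    · simp only [if_neg h1, if_neg h2]
      rw [charBlock_coboundary hχ (by omega) (by omega), sum_Ico_eq_sum_range,
        sum_Ico_eq_sum_range]
      refine sum_congr (by congr 1) fun m _ => ?_
      rw [if_neg (by omega), if_neg (by omega)]
      congr 2 <;> omega

end Cochains

/-- Inverting, transposing along the antidiagonal and conjugating by signs reverses a complete
defining system. -/
lemma exists_isCompleteDefiningSystem_reverse {G : Type*} [Group G] [TopologicalSpace G]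
    [ContinuousInv G] {p n : ℕ} {a a' : ℕ → G → ZMod p} {M : ℕ → ℕ → G → ZMod p}
    (hM : IsCompleteDefiningSystem n a M)
    (ha : ∀ i, 1 ≤ i → i ≤ n → ∀ σ, a (n + 1 - i) σ⁻¹ = -a' i σ) :
    ∃ M', IsCompleteDefiningSystem n a' M' := by
  obtain ⟨hc, hd, hm⟩ := hM
  refine ⟨fun i j σ => (-1) ^ (j - i) * M (n + 2 - j) (n + 2 - i) σ⁻¹, ?_, ?_, ?_⟩
  · intro i j _ _ _
    have h := cts_iff_isLocallyConstant.mp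
      (hc (n + 2 - j) (n + 2 - i) (by omega) (by omega) (by omega))
    exact cts_iff_isLocallyConstant.mpr
      ((h.comp_continuous continuous_inv).comp fun x => (-1) ^ (j - i) * x)
  · intro i hi hin
    funext σ
    dsimp only
    have h : n + 2 - i = n + 2 - (i + 1) + 1 := by omega
    rw [h, hd _ (by omega) (by omega), show n + 2 - (i + 1) = n + 1 - i by omega, ha i hi hin]
    simp
  · intro i j hi hij hj σ τ
    have h := hm (n + 2 - j) (n + 2 - i) (by omega) (by omega) (by omega) τ⁻¹ σ⁻¹
    rw [← mul_inv_rev] at h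
    calc _ = (-1) ^ (j - i) * (M (n + 2 - j) (n + 2 - i) τ⁻¹ + M (n + 2 - j) (n + 2 - i) σ⁻¹
            - M (n + 2 - j) (n + 2 - i) (σ * τ)⁻¹) := by ring
      _ = _ := by
        rw [h, mul_sum]
        refine sum_nbij' (fun l => n + 2 - l) (fun l => n + 2 - l) ?_ ?_ ?_ ?_ ?_
        · intro l hl; rw [mem_Ico] at hl ⊢; omega
        · intro l hl; rw [mem_Ico] at hl ⊢; omega
        · intro l hl; rw [mem_Ico] at hl; omega
        · intro l hl; rw [mem_Ico] at hl; omega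
        · intro l hl
          rw [mem_Ico] at hl
          dsimp only
          rw [show j - i = (n + 2 - l - i) + (j - (n + 2 - l)) by omega, pow_add,
            show n + 2 - (n + 2 - l) = l by omega]
          ring

section Galois

variable {F Fs : Type*} [Field F] [Field Fs] [Algebra F Fs] {p : ℕ} [Fact p.Prime] {ξ : F}

/-- The character `x ↦ ξ ^ x` of `ZMod p` with values in the `p`-th roots of unity of `Fs`. -/
noncomputable def rootChar (Fs : Type*) [Field Fs] [Algebra F Fs] (hξ : IsPrimitiveRoot ξ p) :
    AddChar (ZMod p) Fs :=
  AddChar.zmodChar p (ζ := algebraMap F Fs ξ) (by rw [← map_pow, hξ.pow_eq_one, map_one])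

variable (hξ : IsPrimitiveRoot ξ p)

lemma rootChar_apply (x : ZMod p) : rootChar Fs hξ x = algebraMap F Fs ξ ^ x.val :=
  AddChar.zmodChar_apply _ x

lemma map_rootChar (σ : Fs ≃ₐ[F] Fs) (x : ZMod p) : σ (rootChar Fs hξ x) = rootChar Fs hξ x := by
  rw [rootChar_apply, map_pow, AlgEquiv.commutes]

lemma rootChar_ne_zero (x : ZMod p) : rootChar Fs hξ x ≠ 0 :=
  (AddChar.val_isUnit _ x).ne_zero

lemma rootChar_injective : Function.Injective (rootChar Fs hξ) := fun x y h => by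
  rw [rootChar_apply, rootChar_apply] at h
  exact ZMod.val_injective p ((hξ.map_of_injective (algebraMap F Fs).injective).pow_inj
    (ZMod.val_lt x) (ZMod.val_lt y) h)

lemma exists_eq_rootChar_mul {z w : Fs} (hw : w ≠ 0) (h : z ^ p = w ^ p) :
    ∃ x, z = rootChar Fs hξ x * w := by
  obtain ⟨i, -, hi⟩ := (hξ.map_of_injective (algebraMap F Fs).injective).eq_pow_of_pow_eq_one
    (ξ := z / w) (by rw [div_pow, h, div_self (pow_ne_zero _ hw)])
  refine ⟨i, ?_⟩
  rw [rootChar, AddChar.zmodChar_apply', hi, div_mul_cancel₀ _ hw]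

lemma kummerChar_mul {r : Fs} {χ : (Fs ≃ₐ[F] Fs) → ZMod p} (hr : r ≠ 0)
    (hχ : ∀ σ : Fs ≃ₐ[F] Fs, σ r = rootChar Fs hξ (χ σ) * r) (σ τ : Fs ≃ₐ[F] Fs) :
    χ (σ * τ) = χ σ + χ τ := by
  have h := hχ (σ * τ)
  rw [AlgEquiv.mul_apply, hχ τ, map_mul, map_rootChar, hχ σ, ← mul_assoc, ← AddChar.map_add_eq_mul]
    at h
  rw [add_comm]
  exact (rootChar_injective hξ (mul_right_cancel₀ hr h)).symm

/-- **Hilbert 90** for a continuous character of the kernel of `χ` with values in the `p`-th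
roots of unity. -/
lemma exists_eigenvector [IsGalois F Fs] {χ ψ : (Fs ≃ₐ[F] Fs) → ZMod p}
    (hχ : ∀ σ τ, χ (σ * τ) = χ σ + χ τ) (hχc : IsLocallyConstant χ) (hψc : IsLocallyConstant ψ)
    (hψ : ∀ σ τ, χ σ = 0 → χ τ = 0 → ψ (σ * τ) = ψ σ + ψ τ) :
    ∃ w : Fs, w ≠ 0 ∧ ∀ σ, χ σ = 0 → σ w = rootChar Fs hξ (ψ σ) * w := by
  by_cases htriv : ∀ σ, χ σ = 0 → ψ σ = 0
  · exact ⟨1, one_ne_zero, fun σ hσ => by rw [htriv σ hσ, AddChar.map_zero_eq_one]; simp⟩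
  push Not at htriv
  obtain ⟨σ₁, hχσ₁, hψσ₁⟩ := htriv
  have hχ1 : χ 1 = 0 := char_one hχ
  have hψ1 : ψ 1 = 0 := by simpa using hψ 1 1 hχ1 hχ1
  have hχinv := char_inv hχ
  have hψinv : ∀ σ, χ σ = 0 → ψ σ⁻¹ = -ψ σ := fun σ hσ => by
    have h := hψ σ σ⁻¹ hσ (by rw [hχinv, hσ, neg_zero])
    rw [mul_inv_cancel, hψ1] at h
    linear_combination -h
  have hpow : ∀ σ, χ σ = 0 → ∀ n : ℕ, χ (σ ^ n) = 0 ∧ ψ (σ ^ n) = n * ψ σ := fun σ hσ n => by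
    induction n with
    | zero => simp [hχ1, hψ1]
    | succ n ih =>
      rw [pow_succ, hχ, hψ _ _ ih.1 hσ, ih.1, ih.2, hσ]
      exact ⟨add_zero 0, by push_cast; ring⟩
  obtain ⟨σ₀, hχσ₀, hψσ₀⟩ : ∃ σ₀, χ σ₀ = 0 ∧ ψ σ₀ = 1 :=
    ⟨σ₁ ^ (ψ σ₁)⁻¹.val, (hpow σ₁ hχσ₁ _).1, by
      rw [(hpow σ₁ hχσ₁ _).2, ZMod.natCast_zmod_val, inv_mul_cancel₀ hψσ₁]⟩
  have hχpow : ∀ i : ZMod p, χ (σ₀ ^ i.val) = 0 := fun i => (hpow σ₀ hχσ₀ _).1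
  have hψpow : ∀ i : ZMod p, ψ (σ₀ ^ i.val) = i := fun i => by
    rw [(hpow σ₀ hχσ₀ _).2, hψσ₀, ZMod.natCast_zmod_val, mul_one]
  let K : ClosedSubgroup (Fs ≃ₐ[F] Fs) :=
    { carrier := {σ | χ σ = 0} ∩ {σ | ψ σ = 0}
      one_mem' := ⟨hχ1, hψ1⟩
      mul_mem' := fun {σ τ} hσ hτ =>
        ⟨show χ (σ * τ) = 0 by rw [hχ, hσ.1, hτ.1, add_zero],
          show ψ (σ * τ) = 0 by rw [hψ _ _ hσ.1 hτ.1, hσ.2, hτ.2, add_zero]⟩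
      inv_mem' := fun {σ} hσ =>
        ⟨show χ σ⁻¹ = 0 by rw [hχinv, hσ.1, neg_zero],
          show ψ σ⁻¹ = 0 by rw [hψinv _ hσ.1, hσ.2, neg_zero]⟩
      isClosed' := (hχc.isClosed_fiber 0).inter (hψc.isClosed_fiber 0) }
  let L := IntermediateField.fixedField K.toSubgroup
  let g : ZMod p → L →* Fs := fun i => ((σ₀ ^ i.val : Fs ≃ₐ[F] Fs) : Fs →* Fs).comp
    (L.val : L →* Fs)
  have hg : Function.Injective g := fun i j hij => by
    have hmem : (σ₀ ^ i.val)⁻¹ * σ₀ ^ j.val ∈ L.fixingSubgroup := by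
      rw [IntermediateField.mem_fixingSubgroup_iff]
      intro x hx
      have hx' : (σ₀ ^ i.val) x = (σ₀ ^ j.val) x := DFunLike.congr_fun hij ⟨x, hx⟩
      rw [AlgEquiv.mul_apply, ← hx', ← AlgEquiv.mul_apply, inv_mul_cancel, AlgEquiv.one_apply]
    rw [InfiniteGalois.fixingSubgroup_fixedField K] at hmem
    have h := hψ _ _ (hχpow i) hmem.1
    rw [mul_inv_cancel_left, hψpow, hψpow, hmem.2, add_zero] at h
    exact h.symm
  obtain ⟨x, hx⟩ : ∃ x : L, ∑ i, rootChar Fs hξ (-i) * (σ₀ ^ i.val) (x : Fs) ≠ 0 := by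
    by_contra! hzero
    have hli := (linearIndependent_monoidHom L Fs).comp g hg
    rw [Fintype.linearIndependent_iff] at hli
    refine rootChar_ne_zero (Fs := Fs) hξ (-0) (hli (fun i => rootChar Fs hξ (-i)) ?_ 0)
    funext x
    simpa [g] using hzero x
  refine ⟨_, hx, fun σ hσ => ?_⟩
  have hshift : ∀ i : ZMod p, σ ((σ₀ ^ i.val) (x : Fs)) = (σ₀ ^ (i + ψ σ).val) (x : Fs) := by
    intro i
    have hχk : χ ((σ₀ ^ (i + ψ σ).val)⁻¹ * (σ * σ₀ ^ i.val)) = 0 := by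
      rw [hχ, hχ, hχinv, hχpow, hχpow, hσ, neg_zero, add_zero, add_zero]
    have hψk := hψ _ _ (hχpow (i + ψ σ)) hχk
    rw [mul_inv_cancel_left, hψpow, hψ _ _ hσ (hχpow i), hψpow] at hψk
    have hfix := x.2 ⟨_, hχk, show ψ _ = 0 by linear_combination -hψk⟩
    have := congrArg (σ₀ ^ (i + ψ σ).val) hfix
    change (σ₀ ^ (i + ψ σ).val * ((σ₀ ^ (i + ψ σ).val)⁻¹ * (σ * σ₀ ^ i.val))) (x : Fs) = _ at this
    rwa [mul_inv_cancel_left] at this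
  simp only [map_sum, map_mul, map_rootChar, hshift, mul_sum]
  refine Fintype.sum_equiv (Equiv.addRight (ψ σ)) _ _ fun i => ?_
  rw [Equiv.coe_addRight, ← mul_assoc, ← AddChar.map_add_eq_mul]
  congr 2
  ring

/-- If the cup product of two Kummer characters vanishes, then `b` is a norm from the cyclic
extension cut out by the first one. -/
lemma exists_norm_eq [IsGalois F Fs] {χ ψ φ : (Fs ≃ₐ[F] Fs) → ZMod p} {r : Fs} (hr : r ≠ 0)
    (hχ : ∀ σ τ, χ (σ * τ) = χ σ + χ τ) (hχc : IsLocallyConstant χ)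
    (hψ : ∀ σ : Fs ≃ₐ[F] Fs, σ r = rootChar Fs hξ (ψ σ) * r) (hφc : IsLocallyConstant φ)
    (hφ : ∀ σ τ, φ σ + φ τ - φ (σ * τ) = χ σ * ψ τ) {τ : Fs ≃ₐ[F] Fs} (hτ : χ τ = 1) :
    ∃ y : Fs, (∀ σ, χ σ = 0 → σ y = y) ∧ ∏ i ∈ range p, (τ ^ i) y = r ^ p := by
  have hψmul := kummerChar_mul hξ hr hψ
  obtain ⟨w, hw, hwφ⟩ := exists_eigenvector hξ hχ hχc hφc fun σ τ hσ _ => by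
    linear_combination -hφ σ τ - ψ τ * hσ
  have hw' : ∀ σ : Fs ≃ₐ[F] Fs, σ w ≠ 0 := fun σ => by simpa using hw
  let D : (Fs ≃ₐ[F] Fs) → ℕ → Fs := fun σ m =>
    rootChar Fs hξ (φ σ + χ σ * ψ σ) * r ^ m * (w / σ w)
  have hD : ∀ σ τ (m n : ℕ), χ σ = m → χ τ = n → D σ m * σ (D τ n) = D (σ * τ) (m + n) := by
    intro σ τ m n hm hn
    have hroot : rootChar Fs hξ (φ (σ * τ) + χ (σ * τ) * ψ (σ * τ)) =
        rootChar Fs hξ (φ σ + χ σ * ψ σ) * rootChar Fs hξ (φ τ + χ τ * ψ τ) *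
          rootChar Fs hξ (ψ σ) ^ n := by
      rw [← AddChar.map_nsmul_eq_pow, ← AddChar.map_add_eq_mul, ← AddChar.map_add_eq_mul,
        nsmul_eq_mul, ← hn, hχ, hψmul]
      congr 1
      linear_combination -hφ σ τ
    have h₁ := hw' σ
    have h₂ := hw' (σ * τ)
    rw [AlgEquiv.mul_apply] at h₂
    simp only [D, map_mul, map_div₀, map_pow, map_rootChar, hψ σ, hroot, AlgEquiv.mul_apply]
    field_simp
    ring
  have hD0 : ∀ σ, χ σ = 0 → D σ 0 = 1 := fun σ hσ => by
    simp only [D, hσ, hwφ σ hσ]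
    have := rootChar_ne_zero (Fs := Fs) hξ (φ σ)
    simp
    field_simp
  have hχ1 : χ 1 = 0 := char_one hχ
  have hχinv := char_inv hχ
  have hχpow : ∀ i : ℕ, χ (τ ^ i) = i := fun i => by rw [char_pow hχ, hτ, mul_one]
  refine ⟨D τ 1, fun σ hσ => ?_, ?_⟩
  · have h₁ := hD σ τ 0 1 (by simpa using hσ) (by simpa using hτ)
    have hχ' : χ (τ⁻¹ * (σ * τ)) = 0 := by rw [hχ, hχ, hχinv, hσ]; ring
    have h₂ := hD τ (τ⁻¹ * (σ * τ)) 1 0 (by simpa using hτ) (by simpa using hχ')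
    rw [hD0 _ hσ, one_mul] at h₁
    rw [hD0 _ hχ', map_one, mul_one, mul_inv_cancel_left] at h₂
    rw [h₁, h₂]
  · have hprod : ∀ n : ℕ, ∏ i ∈ range n, (τ ^ i) (D τ 1) = D (τ ^ n) n := fun n => by
      induction n with
      | zero => simpa using (hD0 1 hχ1).symm
      | succ n ih =>
        rw [prod_range_succ, ih, hD _ _ _ _ (hχpow n) (by simpa using hτ), pow_succ]
    have hχp : χ (τ ^ p) = 0 := by rw [hχpow, ZMod.natCast_self]
    have h := hD0 _ hχp
    rw [hprod]
    simp only [D, pow_zero, mul_one] at h ⊢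
    linear_combination r ^ p * h

lemma isOpen_setOf_apply_eq [Algebra.IsIntegral F Fs] (x y : Fs) :
    IsOpen {σ : Fs ≃ₐ[F] Fs | σ x = y} := by
  rw [isOpen_iff_mem_nhds]
  intro σ hσ
  have hopen := (stabilizer_isOpen_of_isIntegral (K := F) x).leftCoset σ
  refine Filter.mem_of_superset (hopen.mem_nhds ⟨1, one_mem _, mul_one σ⟩) ?_
  rintro _ ⟨τ, hτ, rfl⟩
  have hτx : τ x = x := hτ
  simpa [hτx] using hσ

/-- A norm representation of the radicand of `ψ` lifts `ψ` to a continuous cocycle with values in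
the module induced from the kernel of `χ`. -/
lemma exists_induced_cocycle [IsSepClosed Fs] [IsGalois F Fs] [NeZero (p : Fs)]
    {χ ψ : (Fs ≃ₐ[F] Fs) → ZMod p}
    {r : Fs} (hr : r ≠ 0) (hχ : ∀ σ τ, χ (σ * τ) = χ σ + χ τ) (hχc : IsLocallyConstant χ)
    (hψ : ∀ σ : Fs ≃ₐ[F] Fs, σ r = rootChar Fs hξ (ψ σ) * r)
    {τ : Fs ≃ₐ[F] Fs} (hτ : χ τ = 1) {y : Fs} (hy : ∀ σ, χ σ = 0 → σ y = y)
    (hnorm : ∏ i ∈ range p, (τ ^ i) y = r ^ p) :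
    ∃ f : ZMod p → (Fs ≃ₐ[F] Fs) → ZMod p, (∀ i, IsLocallyConstant (f i)) ∧
      (∀ i σ τ, f i (σ * τ) = f i τ + f (i + χ τ) σ) ∧ ∀ σ, ∑ i, f i σ = ψ σ := by
  have hχinv := char_inv hχ
  have hχpow : ∀ i : ℕ, χ (τ ^ i) = i := fun i => by rw [char_pow hχ, hτ, mul_one]
  obtain ⟨s, hs⟩ := IsSepClosed.exists_pow_nat_eq y p
  have hp0 : p ≠ 0 := (Fact.out : p.Prime).ne_zero
  let t : ZMod p → Fs := fun i => (τ ^ i.val) s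
  have hprod : (∏ i, t i) ^ p = r ^ p := by
    rw [← hnorm, ← prod_pow]
    refine prod_bij (fun i _ => i.val) (fun i _ => mem_range.mpr (ZMod.val_lt i))
      (fun i _ j _ h => ZMod.val_injective p h)
      (fun n hn => ⟨n, mem_univ _, ZMod.val_cast_of_lt (mem_range.mp hn)⟩) fun i _ => ?_
    rw [← map_pow, hs]
  have hprod0 : ∏ i, t i ≠ 0 := fun h => by
    rw [h, zero_pow hp0] at hprod
    exact pow_ne_zero p hr hprod.symm
  have ht0 : ∀ i, t i ≠ 0 := fun i => prod_ne_zero_iff.mp hprod0 i (mem_univ i)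
  have hpow : ∀ (σ : Fs ≃ₐ[F] Fs) i, σ (t i) ^ p = t (i + χ σ) ^ p := fun σ i => by
    have hfix := hy ((τ ^ (i + χ σ).val)⁻¹ * (σ * τ ^ i.val)) (by
      rw [hχ, hχ, hχinv, hχpow, hχpow, ZMod.natCast_zmod_val, ZMod.natCast_zmod_val]; ring)
    have := congrArg (τ ^ (i + χ σ).val) hfix
    rw [← AlgEquiv.mul_apply, mul_inv_cancel_left, AlgEquiv.mul_apply] at this
    simp only [t, ← map_pow, hs]
    exact this
  choose f hf using fun i (σ : Fs ≃ₐ[F] Fs) =>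
    exists_eq_rootChar_mul hξ (ht0 (i + χ σ)) (hpow σ i)
  refine ⟨f, fun i => ?_, fun i σ τ => ?_, fun σ => ?_⟩
  · rw [IsLocallyConstant.iff_eventually_eq]
    intro σ
    filter_upwards [hχc.eventually_eq σ, (isOpen_setOf_apply_eq (t i) (σ (t i))).mem_nhds rfl]
      with τ hχτ hτt
    have h : τ (t i) = σ (t i) := hτt
    rw [hf, hf i σ, hχτ] at h
    exact rootChar_injective hξ (mul_right_cancel₀ (ht0 _) h)
  · have h := hf i (σ * τ)
    rw [AlgEquiv.mul_apply, hf i τ, map_mul, map_rootChar, hf _ σ, ← mul_assoc,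
      ← AddChar.map_add_eq_mul, hχ, add_comm (χ σ), ← add_assoc] at h
    exact (rootChar_injective hξ (mul_right_cancel₀ (ht0 _) h)).symm
  · obtain ⟨c, hc⟩ := exists_eq_rootChar_mul hξ hr hprod
    have h₁ : σ (∏ i, t i) = rootChar Fs hξ (∑ i, f i σ) * ∏ i, t i := by
      have hsum : rootChar Fs hξ (∑ i, f i σ) = ∏ i, rootChar Fs hξ (f i σ) :=
        map_prod (rootChar Fs hξ).toMonoidHom (fun i => Multiplicative.ofAdd (f i σ)) univ
      rw [map_prod, hsum]
      simp only [hf _ σ, prod_mul_distrib]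
      congr 1
      exact Fintype.prod_equiv (Equiv.addRight (χ σ)) _ _ fun i => rfl
    have h₂ : σ (∏ i, t i) = rootChar Fs hξ (ψ σ) * ∏ i, t i := by
      rw [hc, map_mul, map_rootChar, hψ]
      ring
    exact rootChar_injective hξ (mul_right_cancel₀ hprod0 (h₁.symm.trans h₂))

lemma exists_kummerChar_eq_one [IsGalois F Fs] {a : F} {r : Fs} {χ : (Fs ≃ₐ[F] Fs) → ZMod p}
    (ha : ∀ c : F, c ^ p ≠ a) (hra : r ^ p = algebraMap F Fs a) (hr : r ≠ 0)
    (hχ : ∀ σ : Fs ≃ₐ[F] Fs, σ r = rootChar Fs hξ (χ σ) * r) : ∃ τ, χ τ = 1 := by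
  have hχmul := kummerChar_mul hξ hr hχ
  obtain ⟨σ, hσ⟩ : ∃ σ, χ σ ≠ 0 := by
    by_contra! h
    obtain ⟨c, hc⟩ := (InfiniteGalois.mem_range_algebraMap_iff_fixed (k := F) r).mpr fun σ => by
      rw [hχ, h, AddChar.map_zero_eq_one, one_mul]
    refine ha c ((algebraMap F Fs).injective ?_)
    rw [map_pow, hc, hra]
  exact ⟨σ ^ (χ σ)⁻¹.val, by rw [char_pow hχmul, ZMod.natCast_zmod_val, inv_mul_cancel₀ hσ]⟩

end Galois

end MasseyVanishing

/-- Let `F` be a field containing a primitive `p`-th root of unity, `a, b ∈ F^×`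
linearly independent modulo `(F^×)^p` with Kummer characters `χ_a, χ_b`, `k < p` a
positive integer, and assume `χ_a ∪ χ_b` is the coboundary of a continuous 1-cochain.
Then: (1) the `(k+1)`-fold Massey products `⟨χ_b, χ_a, …, χ_a⟩` and
`⟨χ_a, …, χ_a, χ_b⟩` (each with `k` copies of `χ_a`) are defined and contain `0`; and
(2) the `(k+2)`-fold Massey products `⟨χ_a, χ_b, χ_a, …, χ_a⟩` and
`⟨χ_a, …, χ_a, χ_b, χ_a⟩` (each with `k+1` copies of `χ_a`) are defined and
contain `0`. -/
theorem vanishing_higher_massey_products (p : ℕ) [Fact p.Prime]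
    (F Fs : Type*) [Field F] [Field Fs] [Algebra F Fs] [IsSepClosure F Fs]
    (ξ : F) (hξ : IsPrimitiveRoot ξ p)
    (a b : F) (ha : a ≠ 0) (hb : b ≠ 0) (hab : LinIndepModP p a b)
    (ra rb : Fs) (hra : ra ^ p = algebraMap F Fs a) (hrb : rb ^ p = algebraMap F Fs b)
    (χa χb : (Fs ≃ₐ[F] Fs) → ZMod p)
    (hχa : IsKummerChar ξ ra χa) (hχb : IsKummerChar ξ rb χb)
    (hχa_cts : Cts χa) (hχb_cts : Cts χb)
    (k : ℕ) (hk1 : 1 ≤ k) (hkp : k < p)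
    (hcup : ∃ φ : (Fs ≃ₐ[F] Fs) → ZMod p, Cts φ ∧
      ∀ σ τ : Fs ≃ₐ[F] Fs, φ σ + φ τ - φ (σ * τ) = χa σ * χb τ) :
    (∃ M : ℕ → ℕ → (Fs ≃ₐ[F] Fs) → ZMod p,
      IsCompleteDefiningSystem (k + 1) (fun i σ => if i = 1 then χb σ else χa σ) M) ∧
    (∃ M : ℕ → ℕ → (Fs ≃ₐ[F] Fs) → ZMod p,
      IsCompleteDefiningSystem (k + 1) (fun i σ => if i = k + 1 then χb σ else χa σ) M) ∧
    (∃ M : ℕ → ℕ → (Fs ≃ₐ[F] Fs) → ZMod p,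
      IsCompleteDefiningSystem (k + 2) (fun i σ => if i = 2 then χb σ else χa σ) M) ∧
    (∃ M : ℕ → ℕ → (Fs ≃ₐ[F] Fs) → ZMod p,
      IsCompleteDefiningSystem (k + 2)
        (fun i σ => if i = k + 1 then χb σ else χa σ) M) := by
  have hp := (Fact.out : p.Prime)
  have hsep : IsSepClosed Fs := IsSepClosure.sep_closed F
  have hpF : NeZero (p : F) := hξ.neZero'
  have hpFs : NeZero (p : Fs) := ⟨by
    rw [← map_natCast (algebraMap F Fs), Ne, map_eq_zero]
    exact hpF.out⟩
  have hra0 : ra ≠ 0 := fun h => by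
    rw [h, zero_pow hp.ne_zero, eq_comm, map_eq_zero] at hra
    exact ha hra
  have hrb0 : rb ≠ 0 := fun h => by
    rw [h, zero_pow hp.ne_zero, eq_comm, map_eq_zero] at hrb
    exact hb hrb
  have hKa : ∀ σ : Fs ≃ₐ[F] Fs, σ ra = MasseyVanishing.rootChar Fs hξ (χa σ) * ra := fun σ => by
    rw [MasseyVanishing.rootChar_apply, hχa]
  have hKb : ∀ σ : Fs ≃ₐ[F] Fs, σ rb = MasseyVanishing.rootChar Fs hξ (χb σ) * rb := fun σ => by
    rw [MasseyVanishing.rootChar_apply, hχb]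
  have hmula := MasseyVanishing.kummerChar_mul hξ hra0 hKa
  have hmulb := MasseyVanishing.kummerChar_mul hξ hrb0 hKb
  have hca := MasseyVanishing.cts_iff_isLocallyConstant.mp hχa_cts
  obtain ⟨φ, hφc, hφ⟩ := hcup
  have hapow : ∀ c : F, c ^ p ≠ a := fun c hc => by
    have hc0 : c ≠ 0 := fun h => ha (by rw [← hc, h, zero_pow hp.ne_zero])
    have h := (hab 1 0 ⟨c, hc0, by simp [hc]⟩).1
    exact hp.one_lt.ne' (by exact_mod_cast Int.eq_one_of_dvd_one (by positivity) h)
  obtain ⟨τ, hτ⟩ := MasseyVanishing.exists_kummerChar_eq_one hξ hapow hra hra0 hKa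
  obtain ⟨y, hy, hnorm⟩ := MasseyVanishing.exists_norm_eq hξ hrb0 hmula hca hKb
    (MasseyVanishing.cts_iff_isLocallyConstant.mp hφc) hφ hτ
  obtain ⟨f, hfc, hf, hfb⟩ :=
    MasseyVanishing.exists_induced_cocycle hξ hrb0 hmula hca hKb hτ hy hnorm
  obtain ⟨M₁, hM₁⟩ :=
    MasseyVanishing.exists_isCompleteDefiningSystem_head hmula hca hfc hf hfb hkp
  obtain ⟨M₂, hM₂⟩ :=
    MasseyVanishing.exists_isCompleteDefiningSystem_second hmula hca hfc hf hfb hkp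
  refine ⟨⟨M₁, hM₁⟩, MasseyVanishing.exists_isCompleteDefiningSystem_reverse hM₁ ?_,
    ⟨M₂, hM₂⟩, MasseyVanishing.exists_isCompleteDefiningSystem_reverse hM₂ ?_⟩
  · intro i hi hin σ
    by_cases h : i = k + 1
    · simp [h, MasseyVanishing.char_inv hmulb]
    · rw [if_neg (by omega), if_neg h, MasseyVanishing.char_inv hmula]
  · intro i hi hin σ
    by_cases h : i = k + 1
    · rw [if_pos (by omega), if_pos h, MasseyVanishing.char_inv hmulb]
    · rw [if_neg (by omega), if_neg h, MasseyVanishing.char_inv hmula]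
end

section
/- Let G = ⟨s⟩ × ⟨t⟩ be a bicyclic group with s of finite order m and t of finite order n, and let M be a G-module (written additively). Suppose (x, y, z) ∈ M³ satisfies D_t x = 0, D_s z = 0, D_s x = N_t y, and D_t z = −N_s y, and suppose moreover that y = D_t α − D_s β for some α, β ∈ M. Then there exist x₀, z₀ ∈ M^G (G-invariant elements) and c, d ∈ M such that x = x₀ + N_t c, y = D_s c − D_t d, and z = z₀ + N_s d. (This expresses the injectivity of the natural map η : coker(u) → coker(v): any 2-cocycle (x, y, z) for the standard free resolution of ℤ over ℤ[G] whose middle entry lies in the image of v is, modulo 2-coboundaries, of the form (x₀, 0, z₀) with x₀, z₀ ∈ M^G.) -/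
section NormOperator

variable {G M : Type*} [CommMonoid G] [AddCommGroup M] [DistribMulAction G M]

/-- `N_g (h • w - w) = h • N_g w - N_g w`. -/
theorem sum_pow_smul_smul_sub (g h : G) (k : ℕ) (w : M) :
    ∑ i ∈ Finset.range k, g ^ i • (h • w - w) =
      h • (∑ i ∈ Finset.range k, g ^ i • w) - ∑ i ∈ Finset.range k, g ^ i • w := by
  simp only [smul_sub, Finset.sum_sub_distrib, Finset.smul_sum, smul_smul, mul_comm]

/-- `N_g (g • w - w) = 0` as soon as `g ^ k = 1`, where `k` is the length of the sum `N_g`. -/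
theorem sum_pow_smul_self_smul_sub {g : G} {k : ℕ} (hg : g ^ k = 1) (w : M) :
    ∑ i ∈ Finset.range k, g ^ i • (g • w - w) = 0 := by
  simp only [smul_sub, smul_smul, ← pow_succ]
  rw [Finset.sum_range_sub (fun i => g ^ i • w), hg, pow_zero, sub_self]

end NormOperator

/-- An element fixed by both standard generators of `ℤ/m × ℤ/n` is fixed by the whole group. -/
theorem smul_eq_self_of_generators {m n : ℕ} [NeZero m] [NeZero n] {X : Type*}
    [MulAction (Multiplicative (ZMod m × ZMod n)) X] {w : X}
    (h₁ : Multiplicative.ofAdd ((1, 0) : ZMod m × ZMod n) • w = w)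
    (h₂ : Multiplicative.ofAdd ((0, 1) : ZMod m × ZMod n) • w = w)
    (g : Multiplicative (ZMod m × ZMod n)) : g • w = w := by
  have hg : g = Multiplicative.ofAdd ((1, 0) : ZMod m × ZMod n) ^ g.toAdd.1.val *
      Multiplicative.ofAdd ((0, 1) : ZMod m × ZMod n) ^ g.toAdd.2.val := by
    apply Multiplicative.toAdd.injective
    ext <;> simp
  rw [← MulAction.mem_stabilizer_iff] at h₁ h₂ ⊢
  rw [hg]
  exact mul_mem (pow_mem h₁ _) (pow_mem h₂ _)

/-- **Injectivity of `η : coker u → coker v` for bicyclic groups.**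
Let `G = ⟨s⟩ × ⟨t⟩` be the bicyclic group with `s` of order `m` and `t` of order `n`
(realized as `Multiplicative (ZMod m × ZMod n)` with `s = (1,0)` and `t = (0,1)`), and
let `M` be a `G`-module. Suppose `(x, y, z) ∈ M³` is a 2-cocycle for the standard free
resolution, i.e. `D_t x = 0`, `D_s z = 0`, `D_s x = N_t y` and `D_t z = −N_s y`
(where `D_g w = g·w − w` and `N_g w = ∑_i g^i·w`), and suppose moreover
`y = D_t α − D_s β` for some `α, β ∈ M` (i.e. `y` lies in the image of `v`). Then there
are `G`-invariant elements `x₀, z₀ ∈ M^G` and `c, d ∈ M` with `x = x₀ + N_t c`,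
`y = D_s c − D_t d` and `z = z₀ + N_s d`; that is, modulo 2-coboundaries, `(x, y, z)`
is of the form `(x₀, 0, z₀)` with `x₀, z₀ ∈ M^G`. -/
theorem bicyclic_cocycle_decomposition (m n : ℕ) [NeZero m] [NeZero n]
    (M : Type*) [AddCommGroup M]
    [DistribMulAction (Multiplicative (ZMod m × ZMod n)) M]
    (s t : Multiplicative (ZMod m × ZMod n))
    (hs : s = Multiplicative.ofAdd ((1, 0) : ZMod m × ZMod n))
    (ht : t = Multiplicative.ofAdd ((0, 1) : ZMod m × ZMod n))
    (x y z : M)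
    (hx : t • x - x = 0)
    (hz : s • z - z = 0)
    (hxy : s • x - x = ∑ i ∈ Finset.range n, t ^ i • y)
    (hzy : t • z - z = -∑ i ∈ Finset.range m, s ^ i • y)
    (hy : ∃ α β : M, y = (t • α - α) - (s • β - β)) :
    ∃ x₀ z₀ c d : M,
      (∀ g : Multiplicative (ZMod m × ZMod n), g • x₀ = x₀) ∧
      (∀ g : Multiplicative (ZMod m × ZMod n), g • z₀ = z₀) ∧
      x = x₀ + ∑ i ∈ Finset.range n, t ^ i • c ∧
      y = (s • c - c) - (t • d - d) ∧
      z = z₀ + ∑ i ∈ Finset.range m, s ^ i • d := by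
  obtain ⟨α, β, rfl⟩ := hy
  have hsm : s ^ m = 1 := by
    rw [hs, ← ofAdd_nsmul]
    simp
  have htn : t ^ n = 1 := by
    rw [ht, ← ofAdd_nsmul]
    simp
  have htβ := sum_pow_smul_self_smul_sub htn β
  have hsα := sum_pow_smul_self_smul_sub hsm α
  rw [sum_pow_smul_smul_sub] at htβ hsα
  simp only [smul_sub (_ ^ _) (_ - _), Finset.sum_sub_distrib] at hxy hzy
  rw [sum_pow_smul_self_smul_sub htn, sum_pow_smul_smul_sub, zero_sub] at hxy
  rw [sum_pow_smul_self_smul_sub hsm, sum_pow_smul_smul_sub, sub_zero] at hzy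
  refine ⟨x + ∑ i ∈ Finset.range n, t ^ i • β, z + ∑ i ∈ Finset.range m, s ^ i • α, -β, -α,
    smul_eq_self_of_generators ?_ ?_, smul_eq_self_of_generators ?_ ?_, ?_, ?_, ?_⟩
  · rw [← hs, ← sub_eq_zero, smul_add, add_sub_add_comm, hxy, neg_add_cancel]
  · rw [← ht, ← sub_eq_zero, smul_add, add_sub_add_comm, hx, htβ, add_zero]
  · rw [← hs, ← sub_eq_zero, smul_add, add_sub_add_comm, hz, hsα, add_zero]
  · rw [← ht, ← sub_eq_zero, smul_add, add_sub_add_comm, hzy, neg_add_cancel]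
  · simp
  · simp only [smul_neg]
    abel
  · simp
end
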